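/- The finer filtration is K(2)-invariant: for every nonnegative half-integer k, every λ, μ ∈ ℂ, every homogeneous f ∈ A, and every homogeneous operator T ∈ D^k_{λμ}, the operator 𝓛_{X_f}(T) = L^μ_{X_f}∘T − (−1)^{p(f)p(T)} T∘L^λ_{X_f} again belongs to D^k_{λμ}. -/

import Mathlib

/-!
Functions on the supercircle `S^{1|2}`: the superalgebra
`A = C^∞(ℝ,ℂ)[ξ₁,ξ₂]`.  An element `f = f₀ + ξ₁f₁ + ξ₂f₂ + ξ₁ξ₂f₁₂`
is encoded by the 4-tuple `(f₀, f₁, f₂, f₁₂)` of functions `ℝ → ℂ`.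
-/

noncomputable section

abbrev SA : Type := (ℝ → ℂ) × (ℝ → ℂ) × (ℝ → ℂ) × (ℝ → ℂ)

namespace SA

def a0 (f : SA) : ℝ → ℂ := f.1
def a1 (f : SA) : ℝ → ℂ := f.2.1
def a2 (f : SA) : ℝ → ℂ := f.2.2.1
def a12 (f : SA) : ℝ → ℂ := f.2.2.2

/-- all four component functions are smooth -/
def Smooth (f : SA) : Prop :=
  ContDiff ℝ (⊤ : ℕ∞) (a0 f) ∧ ContDiff ℝ (⊤ : ℕ∞) (a1 f) ∧ ContDiff ℝ (⊤ : ℕ∞) (a2 f) ∧ ContDiff ℝ (⊤ : ℕ∞) (a12 f)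

/-- the (super-commutative) product of the Grassmann algebra `A`;
`ξᵢ² = 0`, `ξ₁ξ₂ = -ξ₂ξ₁`. -/
def gmul (f g : SA) : SA :=
  (a0 f * a0 g,
   a0 f * a1 g + a1 f * a0 g,
   a0 f * a2 g + a2 f * a0 g,
   a0 f * a12 g + a12 f * a0 g + a1 f * a2 g - a2 f * a1 g)

scoped infixl:70 " ⊙ " => SA.gmul

/-- the unit `1 ∈ A` -/
def one : SA := (1, 0, 0, 0)
/-- the even coordinate `x ∈ A` -/
def xx : SA := (fun t => (t : ℂ), 0, 0, 0)
/-- the odd coordinate `ξ₁ ∈ A` -/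
def xi1 : SA := (0, 1, 0, 0)
/-- the odd coordinate `ξ₂ ∈ A` -/
def xi2 : SA := (0, 0, 1, 0)

/-- `∂_x`, differentiating the coefficients -/
def dx (f : SA) : SA := (deriv (a0 f), deriv (a1 f), deriv (a2 f), deriv (a12 f))
/-- the left Grassmann derivative `∂_{ξ₁}` -/
def dxi1 (f : SA) : SA := (a1 f, 0, a12 f, 0)
/-- the left Grassmann derivative `∂_{ξ₂}` -/
def dxi2 (f : SA) : SA := (a2 f, -a12 f, 0, 0)
/-- `D̄₁ = ∂_{ξ₁} - ξ₁∂_x` -/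
def D1 (f : SA) : SA := dxi1 f - xi1 ⊙ dx f
/-- `D̄₂ = ∂_{ξ₂} - ξ₂∂_x` -/
def D2 (f : SA) : SA := dxi2 f - xi2 ⊙ dx f

def IsEven (f : SA) : Prop := a1 f = 0 ∧ a2 f = 0
def IsOdd (f : SA) : Prop := a0 f = 0 ∧ a12 f = 0
/-- `f` is homogeneous of parity `b` (`false` = even, `true` = odd) -/
def Homog (b : Bool) (f : SA) : Prop := if b then IsOdd f else IsEven f
/-- `(-1)^b` -/
def sgn (b : Bool) : ℂ := if b then -1 else 1
/-- `(-1)^(b*c)` -/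
def sgn2 (b c : Bool) : ℂ := if b && c then -1 else 1

/-- the contact vector field `X_f` (with `f` homogeneous of parity `b`)
applied to `g`:  `X_f(g) = f ∂_x g - (-1)^{p(f)} ½ (D̄₁(f)D̄₁(g) + D̄₂(f)D̄₂(g))` -/
def XV (b : Bool) (f : SA) (g : SA) : SA :=
  f ⊙ dx g - (sgn b * (2 : ℂ)⁻¹) • (D1 f ⊙ D1 g + D2 f ⊙ D2 g)

/-- the Lie derivative `L^λ_{X_f} = X_f + λ f'` on `λ`-densities -/
def Lden (b : Bool) (f : SA) (lam : ℂ) (g : SA) : SA :=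
  XV b f g + lam • (dx f ⊙ g)

/-- the contact bracket `{f,g} = fg' - f'g - (-1)^{p(f)} ½ (D̄₁(f)D̄₁(g) + D̄₂(f)D̄₂(g))` -/
def cbr (b : Bool) (f g : SA) : SA :=
  f ⊙ dx g - dx f ⊙ g - (sgn b * (2 : ℂ)⁻¹) • (D1 f ⊙ D1 g + D2 f ⊙ D2 g)

/-- the Lie derivative `𝓛_{X_f}(T) = L^μ_{X_f}∘T - (-1)^{p(f)p(T)} T∘L^λ_{X_f}`
of a homogeneous operator `T` of parity `bT` from `λ`- to `μ`-densities -/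
def LieD (bf : Bool) (f : SA) (lam mu : ℂ) (bT : Bool) (T : SA → SA) : SA → SA :=
  fun g => Lden bf f mu (T g) - sgn2 bf bT • T (Lden bf f lam g)

def applyIf (b : Bool) (F : SA → SA) (g : SA) : SA := if b then F g else g

/-- the monomial operator `∂_x^ℓ D̄₁^m D̄₂^n` -/
def monoD (l : ℕ) (m n : Bool) (g : SA) : SA := dx^[l] (applyIf m D1 (applyIf n D2 g))

def bnat (b : Bool) : ℕ := if b then 1 else 0

/-- membership in `D^{K/2}_{λμ}`: differential operators
`Σ a_{ℓ,m,n} ∂_x^ℓ D̄₁^m D̄₂^n` of contact order `ℓ + m/2 + n/2 ≤ K/2`. -/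
def InD (K : ℕ) (T : SA → SA) : Prop :=
  ∃ a : ℕ → Bool → Bool → SA,
    (∀ l m n, Smooth (a l m n)) ∧
    (∀ l m n, ¬ (2 * l + bnat m + bnat n ≤ K) → a l m n = 0) ∧
    (∀ g, Smooth g →
      T g = ∑ l ∈ Finset.range (K + 1), ∑ m : Bool, ∑ n : Bool, a l m n ⊙ monoD l m n g)

end SA

namespace SA

/-- membership in `D^{K/2}_{λμ}` as a *homogeneous* operator of parity `bT`:
the coefficient of `∂_x^ℓ D̄₁^m D̄₂^n` is homogeneous of parity `bT + m + n`. -/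
def InDp (K : ℕ) (bT : Bool) (T : SA → SA) : Prop :=
  ∃ a : ℕ → Bool → Bool → SA,
    (∀ l m n, Smooth (a l m n)) ∧
    (∀ l m n, Homog (xor bT (xor m n)) (a l m n)) ∧
    (∀ l m n, ¬ (2 * l + bnat m + bnat n ≤ K) → a l m n = 0) ∧
    (∀ g, Smooth g →
      T g = ∑ l ∈ Finset.range (K + 1), ∑ m : Bool, ∑ n : Bool, a l m n ⊙ monoD l m n g)

end SA

open SA


namespace SA

/-! ### Grassmann product -/

/-- the parity automorphism `ξᵢ ↦ -ξᵢ` -/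
def par (f : SA) : SA := (a0 f, -a1 f, -a2 f, a12 f)

lemma gmul_add (f g h : SA) : f ⊙ (g + h) = f ⊙ g + f ⊙ h := by
  simp only [gmul, a0, a1, a2, a12, Prod.mk_add_mk, Prod.mk.injEq, Prod.fst_add, Prod.snd_add]
  refine ⟨?_, ?_, ?_, ?_⟩ <;> ring

lemma add_gmul (f g h : SA) : (f + g) ⊙ h = f ⊙ h + g ⊙ h := by
  simp only [gmul, a0, a1, a2, a12, Prod.mk_add_mk, Prod.mk.injEq, Prod.fst_add, Prod.snd_add]
  refine ⟨?_, ?_, ?_, ?_⟩ <;> ring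

lemma gmul_smul (c : ℂ) (f g : SA) : f ⊙ (c • g) = c • (f ⊙ g) := by
  simp only [gmul, a0, a1, a2, a12, Prod.smul_mk, Prod.smul_fst, Prod.smul_snd, mul_smul_comm,
    smul_add, smul_sub]

lemma smul_gmul (c : ℂ) (f g : SA) : (c • f) ⊙ g = c • (f ⊙ g) := by
  simp only [gmul, a0, a1, a2, a12, Prod.smul_mk, Prod.smul_fst, Prod.smul_snd, smul_mul_assoc,
    smul_add, smul_sub]

lemma neg_gmul (f g : SA) : (-f) ⊙ g = -(f ⊙ g) := by
  simpa using smul_gmul (-1) f g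

lemma gmul_neg (f g : SA) : f ⊙ (-g) = -(f ⊙ g) := by
  simpa using gmul_smul (-1) f g

lemma gmul_sub (f g h : SA) : f ⊙ (g - h) = f ⊙ g - f ⊙ h := by
  rw [sub_eq_add_neg, gmul_add, gmul_neg, sub_eq_add_neg]

lemma sub_gmul (f g h : SA) : (f - g) ⊙ h = f ⊙ h - g ⊙ h := by
  rw [sub_eq_add_neg, add_gmul, neg_gmul, sub_eq_add_neg]

lemma zero_gmul (g : SA) : (0 : SA) ⊙ g = 0 := by
  simpa using smul_gmul 0 0 g

lemma gmul_assoc (f g h : SA) : (f ⊙ g) ⊙ h = f ⊙ (g ⊙ h) := by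
  simp only [gmul, a0, a1, a2, a12, Prod.mk.injEq]
  refine ⟨?_, ?_, ?_, ?_⟩ <;> ring

lemma one_gmul (g : SA) : one ⊙ g = g := by
  obtain ⟨g0, g1, g2, g3⟩ := g
  simp [gmul, one, a0, a1, a2, a12]

lemma gmul_comm_of_homog {b c : Bool} {f g : SA} (hf : Homog b f) (hg : Homog c g) :
    f ⊙ g = sgn2 b c • (g ⊙ f) := by
  obtain ⟨f0, f1, f2, f3⟩ := f
  obtain ⟨g0, g1, g2, g3⟩ := g
  cases b <;> cases c <;>
    simp_all [Homog, IsEven, IsOdd, gmul, a0, a1, a2, a12, sgn2, mul_comm, add_comm,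
      sub_eq_add_neg]

lemma par_of_homog {b : Bool} {f : SA} (hf : Homog b f) : par f = sgn b • f := by
  obtain ⟨f0, f1, f2, f3⟩ := f
  cases b <;> simp_all [Homog, IsEven, IsOdd, par, a0, a1, a2, a12, sgn]

/-! ### Smoothness -/

lemma contDiff_deriv {u : ℝ → ℂ} (hu : ContDiff ℝ (⊤ : ℕ∞) u) :
    ContDiff ℝ (⊤ : ℕ∞) (deriv u) := (contDiff_infty_iff_deriv.1 hu).2

lemma deriv_neg_fun (u : ℝ → ℂ) : deriv (-u) = -deriv u := funext fun _ => deriv.neg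

lemma contDiff_differentiableAt {u : ℝ → ℂ} (hu : ContDiff ℝ (⊤ : ℕ∞) u) (x : ℝ) :
    DifferentiableAt ℝ u x := (contDiff_infty_iff_deriv.1 hu).1 x

lemma smooth_zero : Smooth 0 :=
  ⟨contDiff_const, contDiff_const, contDiff_const, contDiff_const⟩

lemma smooth_one : Smooth one :=
  ⟨contDiff_const, contDiff_const, contDiff_const, contDiff_const⟩

lemma Smooth.add {f g : SA} (hf : Smooth f) (hg : Smooth g) : Smooth (f + g) :=
  ⟨hf.1.add hg.1, hf.2.1.add hg.2.1, hf.2.2.1.add hg.2.2.1, hf.2.2.2.add hg.2.2.2⟩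

lemma Smooth.neg {f : SA} (hf : Smooth f) : Smooth (-f) :=
  ⟨hf.1.neg, hf.2.1.neg, hf.2.2.1.neg, hf.2.2.2.neg⟩

lemma Smooth.sub {f g : SA} (hf : Smooth f) (hg : Smooth g) : Smooth (f - g) :=
  ⟨hf.1.sub hg.1, hf.2.1.sub hg.2.1, hf.2.2.1.sub hg.2.2.1, hf.2.2.2.sub hg.2.2.2⟩

lemma Smooth.smul {f : SA} (c : ℂ) (hf : Smooth f) : Smooth (c • f) :=
  ⟨contDiff_const.mul hf.1, contDiff_const.mul hf.2.1, contDiff_const.mul hf.2.2.1,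
    contDiff_const.mul hf.2.2.2⟩

lemma Smooth.gmul {f g : SA} (hf : Smooth f) (hg : Smooth g) : Smooth (f ⊙ g) := by
  obtain ⟨f0, f1, f2, f3⟩ := hf
  obtain ⟨g0, g1, g2, g3⟩ := hg
  exact ⟨f0.mul g0, (f0.mul g1).add (f1.mul g0), (f0.mul g2).add (f2.mul g0),
    (((f0.mul g3).add (f3.mul g0)).add (f1.mul g2)).sub (f2.mul g1)⟩

lemma Smooth.par {f : SA} (hf : Smooth f) : Smooth (par f) :=
  ⟨hf.1, hf.2.1.neg, hf.2.2.1.neg, hf.2.2.2⟩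

lemma Smooth.dx {f : SA} (hf : Smooth f) : Smooth (dx f) :=
  ⟨contDiff_deriv hf.1, contDiff_deriv hf.2.1, contDiff_deriv hf.2.2.1, contDiff_deriv hf.2.2.2⟩

lemma D1_eq (f : SA) : D1 f = (a1 f, -deriv (a0 f), a12 f, -deriv (a2 f)) := by
  simp [D1, dxi1, dx, SA.gmul, xi1, a0, a1, a2, a12]

lemma D2_eq (f : SA) : D2 f = (a2 f, -a12 f, -deriv (a0 f), deriv (a1 f)) := by
  simp [D2, dxi2, dx, SA.gmul, xi2, a0, a1, a2, a12]

lemma Smooth.D1 {f : SA} (hf : Smooth f) : Smooth (D1 f) := by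
  rw [D1_eq]
  exact ⟨hf.2.1, (contDiff_deriv hf.1).neg, hf.2.2.2, (contDiff_deriv hf.2.2.1).neg⟩

lemma Smooth.D2 {f : SA} (hf : Smooth f) : Smooth (D2 f) := by
  rw [D2_eq]
  exact ⟨hf.2.2.1, hf.2.2.2.neg, (contDiff_deriv hf.1).neg, contDiff_deriv hf.2.1⟩

lemma Smooth.XV {b : Bool} {f g : SA} (hf : Smooth f) (hg : Smooth g) : Smooth (XV b f g) :=
  (hf.gmul hg.dx).sub (((hf.D1.gmul hg.D1).add (hf.D2.gmul hg.D2)).smul _)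

lemma Smooth.Lden {b : Bool} {f g : SA} (lam : ℂ) (hf : Smooth f) (hg : Smooth g) :
    Smooth (Lden b f lam g) :=
  (hf.XV hg).add ((hf.dx.gmul hg).smul _)

/-! ### Derivations -/

lemma dx_add {f g : SA} (hf : Smooth f) (hg : Smooth g) : dx (f + g) = dx f + dx g := by
  obtain ⟨f0, f1, f2, f3⟩ := hf
  obtain ⟨g0, g1, g2, g3⟩ := hg
  refine Prod.ext ?_ (Prod.ext ?_ (Prod.ext ?_ ?_)) <;> funext x <;>
    exact deriv_add (contDiff_differentiableAt ‹_› x) (contDiff_differentiableAt ‹_› x)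

lemma dx_smul (c : ℂ) {f : SA} : dx (c • f) = c • dx f := by
  refine Prod.ext ?_ (Prod.ext ?_ (Prod.ext ?_ ?_)) <;> funext x <;>
    exact deriv_const_mul_field c

lemma D1_add {f g : SA} (hf : Smooth f) (hg : Smooth g) : D1 (f + g) = D1 f + D1 g := by
  rw [D1, dx_add hf hg, gmul_add, D1, D1, sub_add_sub_comm]
  simp [dxi1, a1, a12]

lemma D2_add {f g : SA} (hf : Smooth f) (hg : Smooth g) : D2 (f + g) = D2 f + D2 g := by
  rw [D2, dx_add hf hg, gmul_add, D2, D2, sub_add_sub_comm]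
  simp [dxi2, a2, a12, add_comm]

lemma D1_smul (c : ℂ) (f : SA) : D1 (c • f) = c • D1 f := by
  rw [D1, dx_smul, gmul_smul, D1, smul_sub]
  simp [dxi1, a1, a12]

lemma D2_smul (c : ℂ) (f : SA) : D2 (c • f) = c • D2 f := by
  rw [D2, dx_smul, gmul_smul, D2, smul_sub]
  simp [dxi2, a2, a12]

lemma D1_sub {f g : SA} (hf : Smooth f) (hg : Smooth g) : D1 (f - g) = D1 f - D1 g := by
  rw [sub_eq_add_neg, ← neg_one_smul ℂ g, D1_add hf (hg.smul _), D1_smul, neg_one_smul,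
    sub_eq_add_neg]

lemma D2_sub {f g : SA} (hf : Smooth f) (hg : Smooth g) : D2 (f - g) = D2 f - D2 g := by
  rw [sub_eq_add_neg, ← neg_one_smul ℂ g, D2_add hf (hg.smul _), D2_smul, neg_one_smul,
    sub_eq_add_neg]

lemma D1_D1 (f : SA) : D1 (D1 f) = -dx f := by
  simp only [D1_eq, a0, a1, a2, a12, dx, Prod.neg_mk]

lemma D2_D2 (f : SA) : D2 (D2 f) = -dx f := by
  simp only [D2_eq, a0, a1, a2, a12, dx, deriv_neg_fun, Prod.neg_mk]

lemma D2_D1 (f : SA) : D2 (D1 f) = -D1 (D2 f) := by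
  simp only [D1_eq, D2_eq, a0, a1, a2, a12, deriv_neg_fun, Prod.neg_mk, neg_neg]

lemma dx_D1 (f : SA) : dx (D1 f) = D1 (dx f) := by
  simp only [D1_eq, a0, a1, a2, a12, dx, deriv_neg_fun]

lemma dx_D2 (f : SA) : dx (D2 f) = D2 (dx f) := by
  simp only [D2_eq, a0, a1, a2, a12, dx, deriv_neg_fun]

lemma par_D1 (f : SA) : par (D1 f) = -D1 (par f) := by
  simp only [D1_eq, par, a0, a1, a2, a12, deriv_neg_fun, Prod.neg_mk, neg_neg]

lemma par_D2 (f : SA) : par (D2 f) = -D2 (par f) := by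
  simp only [D2_eq, par, a0, a1, a2, a12, deriv_neg_fun, Prod.neg_mk, neg_neg]

lemma dx_gmul {f g : SA} (hf : Smooth f) (hg : Smooth g) :
    dx (f ⊙ g) = dx f ⊙ g + f ⊙ dx g := by
  obtain ⟨f0, f1, f2, f3⟩ := hf
  obtain ⟨g0, g1, g2, g3⟩ := hg
  have cm : ∀ {u v : ℝ → ℂ}, ContDiff ℝ (⊤ : ℕ∞) u → ContDiff ℝ (⊤ : ℕ∞) v →
      ContDiff ℝ (⊤ : ℕ∞) (u * v) := fun hu hv => hu.mul hv
  have ca : ∀ {u v : ℝ → ℂ}, ContDiff ℝ (⊤ : ℕ∞) u → ContDiff ℝ (⊤ : ℕ∞) v →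
      ContDiff ℝ (⊤ : ℕ∞) (u + v) := fun hu hv => hu.add hv
  have hm : ∀ {u v : ℝ → ℂ}, ContDiff ℝ (⊤ : ℕ∞) u → ContDiff ℝ (⊤ : ℕ∞) v →
      deriv (u * v) = deriv u * v + u * deriv v := fun hu hv => funext fun x =>
    deriv_mul (contDiff_differentiableAt hu x) (contDiff_differentiableAt hv x)
  have ha : ∀ {u v : ℝ → ℂ}, ContDiff ℝ (⊤ : ℕ∞) u → ContDiff ℝ (⊤ : ℕ∞) v →
      deriv (u + v) = deriv u + deriv v := fun hu hv => funext fun x =>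
    deriv_add (contDiff_differentiableAt hu x) (contDiff_differentiableAt hv x)
  have hs : ∀ {u v : ℝ → ℂ}, ContDiff ℝ (⊤ : ℕ∞) u → ContDiff ℝ (⊤ : ℕ∞) v →
      deriv (u - v) = deriv u - deriv v := fun hu hv => funext fun x =>
    deriv_sub (contDiff_differentiableAt hu x) (contDiff_differentiableAt hv x)
  refine Prod.ext ?_ (Prod.ext ?_ (Prod.ext ?_ ?_))
  · change deriv (a0 f * a0 g) = deriv (a0 f) * a0 g + a0 f * deriv (a0 g)
    exact hm f0 g0
  · change deriv (a0 f * a1 g + a1 f * a0 g) = (deriv (a0 f) * a1 g + deriv (a1 f) * a0 g) +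
      (a0 f * deriv (a1 g) + a1 f * deriv (a0 g))
    rw [ha (cm f0 g1) (cm f1 g0), hm f0 g1, hm f1 g0]
    ring
  · change deriv (a0 f * a2 g + a2 f * a0 g) = (deriv (a0 f) * a2 g + deriv (a2 f) * a0 g) +
      (a0 f * deriv (a2 g) + a2 f * deriv (a0 g))
    rw [ha (cm f0 g2) (cm f2 g0), hm f0 g2, hm f2 g0]
    ring
  · change deriv (a0 f * a12 g + a12 f * a0 g + a1 f * a2 g - a2 f * a1 g) =
      (deriv (a0 f) * a12 g + deriv (a12 f) * a0 g + deriv (a1 f) * a2 g - deriv (a2 f) * a1 g) +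
      (a0 f * deriv (a12 g) + a12 f * deriv (a0 g) + a1 f * deriv (a2 g) - a2 f * deriv (a1 g))
    rw [hs (ca (ca (cm f0 g3) (cm f3 g0)) (cm f1 g2)) (cm f2 g1),
      ha (ca (cm f0 g3) (cm f3 g0)) (cm f1 g2), ha (cm f0 g3) (cm f3 g0),
      hm f0 g3, hm f3 g0, hm f1 g2, hm f2 g1]
    ring

lemma D1_gmul {f g : SA} (hf : Smooth f) (hg : Smooth g) :
    D1 (f ⊙ g) = D1 f ⊙ g + par f ⊙ D1 g := by
  rw [D1, dx_gmul hf hg]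
  obtain ⟨f0, f1, f2, f3⟩ := f
  obtain ⟨g0, g1, g2, g3⟩ := g
  simp only [D1_eq, dxi1, xi1, dx, par, gmul, a0, a1, a2, a12, Prod.mk_add_mk, Prod.mk_sub_mk,
    Prod.mk.injEq]
  refine ⟨?_, ?_, ?_, ?_⟩ <;> ring

lemma D2_gmul {f g : SA} (hf : Smooth f) (hg : Smooth g) :
    D2 (f ⊙ g) = D2 f ⊙ g + par f ⊙ D2 g := by
  rw [D2, dx_gmul hf hg]
  obtain ⟨f0, f1, f2, f3⟩ := f
  obtain ⟨g0, g1, g2, g3⟩ := g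
  simp only [D2_eq, dxi2, xi2, dx, par, gmul, a0, a1, a2, a12, Prod.mk_add_mk, Prod.mk_sub_mk,
    Prod.mk.injEq]
  refine ⟨?_, ?_, ?_, ?_⟩ <;> ring

lemma Homog.D1 {b : Bool} {f : SA} (hf : Homog b f) : Homog (!b) (D1 f) := by
  rw [D1_eq]
  obtain ⟨f0, f1, f2, f3⟩ := f
  cases b <;> simp_all [Homog, IsEven, IsOdd, a0, a1, a2, a12]

lemma Homog.D2 {b : Bool} {f : SA} (hf : Homog b f) : Homog (!b) (D2 f) := by
  rw [D2_eq]
  obtain ⟨f0, f1, f2, f3⟩ := f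
  cases b <;> simp_all [Homog, IsEven, IsOdd, a0, a1, a2, a12]

lemma Homog.dx {b : Bool} {f : SA} (hf : Homog b f) : Homog b (dx f) := by
  obtain ⟨f0, f1, f2, f3⟩ := f
  cases b <;> simp_all [Homog, IsEven, IsOdd, SA.dx, a0, a1, a2, a12]

/-! ### The Lie derivative of densities -/

lemma Lden_add {b : Bool} {f g h : SA} (lam : ℂ) (hg : Smooth g) (hh : Smooth h) :
    Lden b f lam (g + h) = Lden b f lam g + Lden b f lam h := by
  simp only [Lden, XV, dx_add hg hh, D1_add hg hh, D2_add hg hh, gmul_add]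
  module

lemma Lden_smul (b : Bool) (f g : SA) (lam c : ℂ) :
    Lden b f lam (c • g) = c • Lden b f lam g := by
  simp only [Lden, XV, dx_smul, D1_smul, D2_smul, gmul_smul]
  module

lemma Lden_D1 {b : Bool} {f u : SA} (mu : ℂ) (hf : Smooth f) (hb : Homog b f) (hu : Smooth u) :
    Lden b f mu (D1 u) = sgn b • D1 (Lden b f mu u) + ((-(2 : ℂ)⁻¹) • dx f ⊙ D1 u +
      (2 : ℂ)⁻¹ • D1 (D2 f) ⊙ D2 u + (-(sgn b * mu)) • D1 (dx f) ⊙ u) := by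
  have h1 : Smooth (f ⊙ dx u) := hf.gmul hu.dx
  have h2 : Smooth (D1 f ⊙ D1 u) := hf.D1.gmul hu.D1
  have h3 : Smooth (D2 f ⊙ D2 u) := hf.D2.gmul hu.D2
  have h4 : Smooth (dx f ⊙ u) := hf.dx.gmul hu
  simp only [Lden, XV, D1_add (h1.sub ((h2.add h3).smul _)) (h4.smul _),
    D1_sub h1 ((h2.add h3).smul _), D1_smul, D1_add h2 h3, D1_gmul hf hu.dx,
    D1_gmul hf.D1 hu.D1, D1_gmul hf.D2 hu.D2, D1_gmul hf.dx hu, par_of_homog hb,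
    par_of_homog hb.dx, par_D1, par_D2, D2_smul, D1_D1, D2_D1, dx_D1, neg_gmul, gmul_neg,
    smul_gmul]
  cases b <;> simp only [sgn, Bool.false_eq_true, if_true, if_false] <;> module

lemma Lden_D2 {b : Bool} {f u : SA} (mu : ℂ) (hf : Smooth f) (hb : Homog b f) (hu : Smooth u) :
    Lden b f mu (D2 u) = sgn b • D2 (Lden b f mu u) + ((-(2 : ℂ)⁻¹) • dx f ⊙ D2 u +
      (-(2 : ℂ)⁻¹) • D1 (D2 f) ⊙ D1 u + (-(sgn b * mu)) • D2 (dx f) ⊙ u) := by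
  have h1 : Smooth (f ⊙ dx u) := hf.gmul hu.dx
  have h2 : Smooth (D1 f ⊙ D1 u) := hf.D1.gmul hu.D1
  have h3 : Smooth (D2 f ⊙ D2 u) := hf.D2.gmul hu.D2
  have h4 : Smooth (dx f ⊙ u) := hf.dx.gmul hu
  simp only [Lden, XV, D2_add (h1.sub ((h2.add h3).smul _)) (h4.smul _),
    D2_sub h1 ((h2.add h3).smul _), D2_smul, D2_add h2 h3, D2_gmul hf hu.dx,
    D2_gmul hf.D1 hu.D1, D2_gmul hf.D2 hu.D2, D2_gmul hf.dx hu, par_of_homog hb,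
    par_of_homog hb.dx, par_D1, par_D2, D1_smul, D2_D2, D2_D1, dx_D2, neg_gmul, gmul_neg,
    smul_gmul]
  cases b <;> simp only [sgn, Bool.false_eq_true, if_true, if_false] <;> module

lemma Lden_gmul {b c : Bool} {f a u : SA} (mu : ℂ) (hb : Homog b f)
    (ha : Smooth a) (hc : Homog c a) (hu : Smooth u) :
    Lden b f mu (a ⊙ u) = XV b f a ⊙ u + sgn2 b c • (a ⊙ Lden b f mu u) := by
  have hs : ∀ {e : Bool} {h : SA} (v : SA), Homog e h →
      h ⊙ (a ⊙ v) = sgn2 e c • (a ⊙ (h ⊙ v)) := fun v hh => by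
    rw [← gmul_assoc, gmul_comm_of_homog hh hc, smul_gmul, gmul_assoc]
  simp only [Lden, XV, dx_gmul ha hu, D1_gmul ha hu, D2_gmul ha hu, par_of_homog hc, gmul_add,
    gmul_sub, add_gmul, sub_gmul, smul_gmul, gmul_smul, gmul_assoc, hs _ hb, hs _ hb.D1,
    hs _ hb.D2, hs _ hb.dx]
  cases b <;> cases c <;> simp [sgn, sgn2] <;> module

/-! ### Closure properties of the filtration -/

lemma smooth_monoD (l : ℕ) (m n : Bool) {g : SA} (hg : Smooth g) : Smooth (monoD l m n g) := by
  induction l with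
  | zero => cases m <;> cases n <;> simp [monoD, applyIf, hg, hg.D1, hg.D2, hg.D2.D1]
  | succ l ih =>
    rw [monoD, Function.iterate_succ_apply']
    exact ih.dx

lemma InD.congr {K : ℕ} {T T' : SA → SA} (h : ∀ g, Smooth g → T' g = T g) (hT : InD K T) :
    InD K T' := by
  obtain ⟨a, h1, h2, h3⟩ := hT
  exact ⟨a, h1, h2, fun g hg => (h g hg).trans (h3 g hg)⟩

lemma InD.mono {K K' : ℕ} (h : K ≤ K') {T : SA → SA} (hT : InD K T) : InD K' T := by
  obtain ⟨a, h1, h2, h3⟩ := hT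
  refine ⟨a, h1, fun l m n hl => h2 l m n (by omega), fun g hg => ?_⟩
  rw [h3 g hg]
  refine Finset.sum_subset (Finset.range_subset_range.2 (by omega)) fun l _ hl => ?_
  refine Finset.sum_eq_zero fun m _ => Finset.sum_eq_zero fun n _ => ?_
  rw [Finset.mem_range] at hl
  rw [h2 l m n (by omega), zero_gmul]

lemma inD_zero (K : ℕ) : InD K (fun _ => 0) :=
  ⟨fun _ _ _ => 0, fun _ _ _ => smooth_zero, fun _ _ _ _ => rfl, fun g _ => by simp [zero_gmul]⟩

lemma InD.add {K : ℕ} {T T' : SA → SA} (hT : InD K T) (hT' : InD K T') :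
    InD K (fun g => T g + T' g) := by
  obtain ⟨a, h1, h2, h3⟩ := hT
  obtain ⟨b, k1, k2, k3⟩ := hT'
  refine ⟨fun l m n => a l m n + b l m n, fun l m n => (h1 l m n).add (k1 l m n),
    fun l m n h => by simp only [h2 l m n h, k2 l m n h, add_zero], fun g hg => ?_⟩
  simp only [h3 g hg, k3 g hg, add_gmul, Finset.sum_add_distrib]

lemma gmul_sum {ι : Type*} (a : SA) (s : Finset ι) (F : ι → SA) :
    a ⊙ (∑ i ∈ s, F i) = ∑ i ∈ s, a ⊙ F i :=
  map_sum (⟨⟨fun u => a ⊙ u, by simpa using gmul_smul 0 a 0⟩, gmul_add a⟩ : SA →+ SA) F s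

lemma InD.gmul_left {K : ℕ} {a : SA} (ha : Smooth a) {T : SA → SA} (hT : InD K T) :
    InD K (fun g => a ⊙ T g) := by
  obtain ⟨b, k1, k2, k3⟩ := hT
  refine ⟨fun l m n => a ⊙ b l m n, fun l m n => ha.gmul (k1 l m n),
    fun l m n h => by simpa only [k2 l m n h, smul_zero, zero_smul] using gmul_smul 0 a 0,
    fun g hg => ?_⟩
  simp only [k3 g hg, gmul_sum, gmul_assoc]

lemma InD.smul {K : ℕ} (c : ℂ) {T : SA → SA} (hT : InD K T) : InD K (fun g => c • T g) :=
  (hT.gmul_left (smooth_one.smul c)).congr fun g _ => by rw [smul_gmul, one_gmul]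

lemma inD_gmul_monoD {K l : ℕ} {m n : Bool} (h : 2 * l + bnat m + bnat n ≤ K) {a : SA}
    (ha : Smooth a) : InD K (fun g => a ⊙ monoD l m n g) := by
  classical
  refine ⟨fun l' m' n' => if l' = l ∧ m' = m ∧ n' = n then a else 0, fun l' m' n' => ?_,
    fun l' m' n' h' => if_neg ?_, fun g _ => ?_⟩
  · dsimp only
    split_ifs
    exacts [ha, smooth_zero]
  · rintro ⟨rfl, rfl, rfl⟩
    exact h' h
  · rw [Finset.sum_eq_single_of_mem l (Finset.mem_range.2 (by omega)),
      Finset.sum_eq_single_of_mem m (Finset.mem_univ _),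
      Finset.sum_eq_single_of_mem n (Finset.mem_univ _)]
    · simp
    · intro n' _ hn
      simp [hn, zero_gmul]
    · intro m' _ hm
      simp [hm, zero_gmul]
    · intro l' _ hl
      simp [hl, zero_gmul]

/-- An operator that is a sum of terms `a_{ℓ,m,n} ∂_x^ℓ D̄₁^m D̄₂^n` of order at most `K/2` satisfies
every additive property of operators that holds for all of these terms. -/
lemma sum_monoD_induction {K : ℕ} {P : (SA → SA) → Prop}
    (congr : ∀ T T' : SA → SA, (∀ g, Smooth g → T' g = T g) → P T → P T')
    (zero : P fun _ => 0) (add : ∀ T T', P T → P T' → P fun g => T g + T' g)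
    {a : ℕ → Bool → Bool → SA}
    (term : ∀ l m n, 2 * l + bnat m + bnat n ≤ K → P fun g => a l m n ⊙ monoD l m n g)
    (ha : ∀ l m n, ¬ (2 * l + bnat m + bnat n ≤ K) → a l m n = 0) {T : SA → SA}
    (hT : ∀ g, Smooth g →
      T g = ∑ l ∈ Finset.range (K + 1), ∑ m : Bool, ∑ n : Bool, a l m n ⊙ monoD l m n g) :
    P T := by
  have hsum : ∀ {ι : Type} (s : Finset ι) (F : ι → SA → SA), (∀ i, P (F i)) →
      P fun g => ∑ i ∈ s, F i g := by
    classical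
    intro ι s F hF
    induction s using Finset.induction_on with
    | empty => simpa using zero
    | insert i s hi ih => simpa only [Finset.sum_insert hi] using add _ _ (hF i) ih
  refine congr _ _ hT (hsum _ _ fun l => hsum _ _ fun m => hsum _ _ fun n => ?_)
  by_cases h : 2 * l + bnat m + bnat n ≤ K
  · exact term l m n h
  · exact congr _ _ (fun g _ => by rw [ha l m n h, zero_gmul]) zero

lemma InD.smooth {K : ℕ} {T : SA → SA} (hT : InD K T) {g : SA} (hg : Smooth g) :
    Smooth (T g) := by
  obtain ⟨a, h1, h2, h3⟩ := hT
  refine sum_monoD_induction (P := fun T => Smooth (T g)) (fun T T' h hT => ?_) smooth_zero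
    (fun _ _ h h' => h.add h') (fun l m n _ => (h1 l m n).gmul (smooth_monoD l m n hg)) h2 h3
  rwa [h g hg]

lemma D1_zero : D1 0 = 0 := by simpa using D1_smul 0 0

lemma D2_zero : D2 0 = 0 := by simpa using D2_smul 0 0

lemma dx_iterate_neg (l : ℕ) (g : SA) : dx^[l] (-g) = -dx^[l] g :=
  (Function.Semiconj.iterate_right (f := fun u : SA => -u) (ga := dx) (gb := dx)
    (fun u => by simpa using (dx_smul (-1) (f := u)).symm) l g).symm

lemma D1_dx_iterate (l : ℕ) (g : SA) : D1 (dx^[l] g) = dx^[l] (D1 g) :=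
  Function.Semiconj.iterate_right (f := D1) (fun u => (dx_D1 u).symm) l g

lemma D2_dx_iterate (l : ℕ) (g : SA) : D2 (dx^[l] g) = dx^[l] (D2 g) :=
  Function.Semiconj.iterate_right (f := D2) (fun u => (dx_D2 u).symm) l g

lemma D1_monoD (l : ℕ) (m n : Bool) (g : SA) :
    D1 (monoD l m n g) = if m then -monoD (l + 1) false n g else monoD l true n g := by
  cases m <;> simp [monoD, applyIf, D1_dx_iterate, D1_D1, dx_iterate_neg]

lemma D2_monoD (l : ℕ) (m n : Bool) (g : SA) :
    D2 (monoD l m n g) =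
      sgn (xor m n) • if n then monoD (l + 1) m false g else monoD l m true g := by
  have hneg : ∀ u, D1 (-u) = -D1 u := fun u => by simpa using D1_smul (-1) u
  cases m <;> cases n <;>
    simp [monoD, applyIf, D2_dx_iterate, D2_D2, D2_D1, dx_iterate_neg, sgn, hneg, dx_D1]

lemma InD.D1 {K : ℕ} {T : SA → SA} (hT : InD K T) : InD (K + 1) (fun g => D1 (T g)) := by
  obtain ⟨a, h1, h2, h3⟩ := hT
  refine (sum_monoD_induction
    (P := fun T => (∀ g, Smooth g → Smooth (T g)) ∧ InD (K + 1) (fun g => SA.D1 (T g)))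
    (fun T T' h hT => ⟨fun g hg => (h g hg).symm ▸ hT.1 g hg, hT.2.congr fun g hg => by
      rw [h g hg]⟩)
    ⟨fun _ _ => smooth_zero, by simpa only [D1_zero] using inD_zero _⟩
    (fun T T' hT hT' => ⟨fun g hg => (hT.1 g hg).add (hT'.1 g hg),
      (hT.2.add hT'.2).congr fun g hg => D1_add (hT.1 g hg) (hT'.1 g hg)⟩)
    (fun l m n hl => ⟨fun g hg => (h1 l m n).gmul (smooth_monoD l m n hg), ?_⟩) h2 h3).2
  refine InD.congr (fun g hg => D1_gmul (h1 l m n) (smooth_monoD l m n hg)) ?_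
  refine (inD_gmul_monoD (by omega) (h1 l m n).D1).add (InD.gmul_left (h1 l m n).par ?_)
  simp only [D1_monoD]
  cases m
  · exact (inD_gmul_monoD (l := l) (m := true) (n := n) (by simp [bnat] at *; omega)
      smooth_one).congr fun g _ => by simp [one_gmul]
  · exact (inD_gmul_monoD (l := l + 1) (m := false) (n := n) (by simp [bnat] at *; omega)
      smooth_one.neg).congr fun g _ => by simp [one_gmul, neg_gmul]

lemma InD.D2 {K : ℕ} {T : SA → SA} (hT : InD K T) : InD (K + 1) (fun g => D2 (T g)) := by
  obtain ⟨a, h1, h2, h3⟩ := hT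
  refine (sum_monoD_induction
    (P := fun T => (∀ g, Smooth g → Smooth (T g)) ∧ InD (K + 1) (fun g => SA.D2 (T g)))
    (fun T T' h hT => ⟨fun g hg => (h g hg).symm ▸ hT.1 g hg, hT.2.congr fun g hg => by
      rw [h g hg]⟩)
    ⟨fun _ _ => smooth_zero, by simpa only [D2_zero] using inD_zero _⟩
    (fun T T' hT hT' => ⟨fun g hg => (hT.1 g hg).add (hT'.1 g hg),
      (hT.2.add hT'.2).congr fun g hg => D2_add (hT.1 g hg) (hT'.1 g hg)⟩)
    (fun l m n hl => ⟨fun g hg => (h1 l m n).gmul (smooth_monoD l m n hg), ?_⟩) h2 h3).2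
  refine InD.congr (fun g hg => D2_gmul (h1 l m n) (smooth_monoD l m n hg)) ?_
  refine (inD_gmul_monoD (by omega) (h1 l m n).D2).add (InD.gmul_left (h1 l m n).par ?_)
  simp only [D2_monoD]
  refine InD.smul _ ?_
  cases n
  · exact (inD_gmul_monoD (l := l) (m := m) (n := true) (by simp [bnat] at *; omega)
      smooth_one).congr fun g _ => by simp [one_gmul]
  · exact (inD_gmul_monoD (l := l + 1) (m := m) (n := false) (by simp [bnat] at *; omega)
      smooth_one).congr fun g _ => by simp [one_gmul]

lemma inD_monoD (l : ℕ) (m n : Bool) : InD (2 * l + bnat m + bnat n) (monoD l m n) :=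
  (inD_gmul_monoD le_rfl smooth_one).congr fun _ _ => (one_gmul _).symm

/-! ### The Lie derivative of operators -/

lemma LieD_smul (bf : Bool) (f : SA) (lam mu : ℂ) (b : Bool) (c : ℂ) (T : SA → SA) (g : SA) :
    LieD bf f lam mu b (fun g => c • T g) g = c • LieD bf f lam mu b T g := by
  simp only [LieD, Lden_smul]
  module

lemma inD_lieD_D1 {K : ℕ} {bf b : Bool} {f : SA} (lam mu : ℂ) (hf : Smooth f) (hb : Homog bf f)
    {T : SA → SA} (hT : InD K T) (hL : InD K (LieD bf f lam mu b T)) :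
    InD (K + 1) (LieD bf f lam mu (!b) fun g => D1 (T g)) := by
  refine InD.congr (fun g hg => ?_) ((hL.D1.smul (sgn bf)).add
    (((hT.D1.gmul_left (hf.dx.smul (-(2 : ℂ)⁻¹))).add
      (hT.D2.gmul_left (hf.D2.D1.smul (2 : ℂ)⁻¹))).add
      ((hT.mono K.le_succ).gmul_left (hf.dx.D1.smul (-(sgn bf * mu))))))
  have h1 := hT.smooth hg
  have h2 : Smooth (T (Lden bf f lam g)) := hT.smooth (hf.Lden lam hg)
  simp only [LieD, Lden_D1 mu hf hb h1, D1_sub (hf.Lden mu h1) (h2.smul _), D1_smul]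
  cases bf <;> cases b <;> simp [sgn, sgn2] <;> module

lemma inD_lieD_D2 {K : ℕ} {bf b : Bool} {f : SA} (lam mu : ℂ) (hf : Smooth f) (hb : Homog bf f)
    {T : SA → SA} (hT : InD K T) (hL : InD K (LieD bf f lam mu b T)) :
    InD (K + 1) (LieD bf f lam mu (!b) fun g => D2 (T g)) := by
  refine InD.congr (fun g hg => ?_) ((hL.D2.smul (sgn bf)).add
    (((hT.D2.gmul_left (hf.dx.smul (-(2 : ℂ)⁻¹))).add
      (hT.D1.gmul_left (hf.D2.D1.smul (-(2 : ℂ)⁻¹)))).add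
      ((hT.mono K.le_succ).gmul_left (hf.dx.D2.smul (-(sgn bf * mu))))))
  have h1 := hT.smooth hg
  have h2 : Smooth (T (Lden bf f lam g)) := hT.smooth (hf.Lden lam hg)
  simp only [LieD, Lden_D2 mu hf hb h1, D2_sub (hf.Lden mu h1) (h2.smul _), D2_smul]
  cases bf <;> cases b <;> simp [sgn, sgn2] <;> module

lemma inD_lieD_gmul {K : ℕ} {bf b c : Bool} {f a : SA} (lam mu : ℂ) (hf : Smooth f)
    (hb : Homog bf f) (ha : Smooth a) (hc : Homog c a)
    {T : SA → SA} (hT : InD K T) (hL : InD K (LieD bf f lam mu b T)) :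
    InD K (LieD bf f lam mu (xor c b) fun g => a ⊙ T g) := by
  refine InD.congr (fun g hg => ?_) ((hT.gmul_left (hf.XV (b := bf) ha)).add
    ((hL.gmul_left ha).smul (sgn2 bf c)))
  simp only [LieD, Lden_gmul mu hb ha hc (hT.smooth hg), gmul_sub, gmul_smul]
  cases bf <;> cases b <;> cases c <;> simp [sgn2] <;> module

lemma inD_lieD_monoD {bf : Bool} {f : SA} (lam mu : ℂ) (hf : Smooth f) (hb : Homog bf f)
    (l : ℕ) (m n : Bool) :
    InD (2 * l + bnat m + bnat n) (LieD bf f lam mu (xor m n) (monoD l m n)) := by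
  induction l with
  | zero =>
    have h0 : InD 0 (LieD bf f lam mu false (monoD 0 false false)) :=
      (inD_gmul_monoD (l := 0) (m := false) (n := false) (by simp [bnat])
        (hf.dx.smul (mu - lam))).congr fun g _ => by
          simp only [LieD, monoD, applyIf, Lden, smul_gmul, sgn2, Bool.and_false,
            Bool.false_eq_true, if_false, Function.iterate_zero, id_eq]
          module
    have hn : InD (bnat n) (LieD bf f lam mu n (monoD 0 false n)) := by
      cases n
      · exact h0
      · exact inD_lieD_D2 lam mu hf hb (inD_monoD 0 false false) h0
    cases m
    · simpa [bnat] using hn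
    · have : InD (bnat n + 1) (LieD bf f lam mu (!n) (monoD 0 true n)) :=
        inD_lieD_D1 lam mu hf hb ((inD_monoD 0 false n).mono (by simp [bnat])) hn
      simpa [bnat, add_comm] using this
  | succ l ih =>
    have h := inD_lieD_D1 lam mu hf hb (inD_monoD l m n).D1
      (inD_lieD_D1 lam mu hf hb (inD_monoD l m n) ih)
    have hm : monoD (l + 1) m n = fun g => (-1 : ℂ) • D1 (D1 (monoD l m n g)) := by
      funext g
      simp [D1_D1, monoD, Function.iterate_succ_apply', -Function.iterate_succ]
    rw [Bool.not_not] at h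
    refine ((h.smul (-1)).mono (by omega)).congr fun g _ => ?_
    rw [hm, LieD_smul]

end SA

/-- The finer filtration is `K(2)`-invariant: for every
nonnegative half-integer `k = K/2`, every homogeneous `f ∈ A` and every
homogeneous operator `T ∈ D^k_{λμ}`, the operator
`𝓛_{X_f}(T) = L^μ_{X_f}∘T - (-1)^{p(f)p(T)} T∘L^λ_{X_f}` again belongs to
`D^k_{λμ}`. -/
theorem statement6 :
    ∀ (K : ℕ) (lam mu : ℂ) (bf bT : Bool) (f : SA) (T : SA → SA),
      Smooth f → Homog bf f → InDp K bT T →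
      InD K (LieD bf f lam mu bT T) := by

  intro K lam mu bf bT f T hf hb ⟨a, h1, hp, h2, h3⟩
  refine (sum_monoD_induction
    (P := fun T => (∀ g, Smooth g → Smooth (T g)) ∧ InD K (LieD bf f lam mu bT T))
    (fun T T' h hT => ⟨fun g hg => (h g hg).symm ▸ hT.1 g hg, hT.2.congr fun g hg => by
      simp only [LieD, h g hg, h _ (hf.Lden lam hg)]⟩)
    ⟨fun _ _ => smooth_zero, (inD_zero K).congr fun g _ => ?_⟩
    (fun T T' hT hT' => ⟨fun g hg => (hT.1 g hg).add (hT'.1 g hg),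
      (hT.2.add hT'.2).congr fun g hg => ?_⟩)
    (fun l m n hl => ⟨fun g hg => (h1 l m n).gmul (smooth_monoD l m n hg), ?_⟩) h2 h3).2
  · simpa using LieD_smul bf f lam mu bT 0 (fun _ => 0) g
  · simp only [LieD, Lden_add mu (hT.1 g hg) (hT'.1 g hg)]
    module
  · have h := inD_lieD_gmul lam mu hf hb (h1 l m n) (hp l m n) (inD_monoD l m n)
      (inD_lieD_monoD lam mu hf hb l m n)
    rw [Bool.xor_assoc, Bool.xor_self, Bool.xor_false] at h
    exact h.mono hl
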